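/- Let I ⊂ [0,π) be a measurable set and let φ : ℝ² → ℂ be a Schwartz function. Then ∫_{K_I} |x|^{−1} \hatφ(x) dx = ∫_{K_{I⊥}} |x|^{−1} φ(x) dx. (Equivalently, the distributional Fourier transform of χ_{K_I}(x)·|x|^{−1} is χ_{K_{I⊥}}(x)·|x|^{−1}.) -/

import Mathlib

open MeasureTheory Measure Set Filter Metric
open scoped ENNReal Real Topology Classical

/-- The cone `K_J = {r e^{iθ} : r ∈ ℝ, θ ∈ J} ⊆ ℂ`. -/
def coneOf (J : Set ℝ) : Set ℂ :=
  {z | ∃ r θ : ℝ, θ ∈ J ∧ z = (r : ℂ) * Complex.exp ((θ : ℂ) * Complex.I)}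

/-- The Fourier transform of a function on `ℂ ≅ ℝ²`: `\hat f(ξ) = ∫ f(x) e^{-2πi x·ξ} dx`,
where `x·ξ = Re(x · conj ξ)` is the Euclidean dot product on `ℝ²`. -/
noncomputable def fourierC (f : ℂ → ℂ) (ξ : ℂ) : ℂ :=
  ∫ x : ℂ, f x * Complex.exp ((-(2 * π * (x * (starRingEnd ℂ) ξ).re) : ℝ) * Complex.I)

/-- A Schwartz function is dominated by `C / (1 + ‖z‖²)`. -/
lemma SchwartzMap.exists_norm_le_mul_inv_one_add_sq (φ : SchwartzMap ℂ ℂ) :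
    ∃ C, ∀ z, ‖φ z‖ ≤ C * (1 + ‖z‖ ^ 2)⁻¹ := by
  obtain ⟨C₀, h₀⟩ := φ.decay 0 0
  obtain ⟨C₂, h₂⟩ := φ.decay 2 0
  refine ⟨C₀ + C₂, fun z => ?_⟩
  have h0 := h₀.2 z
  have h2 := h₂.2 z
  simp only [pow_zero, norm_iteratedFDeriv_zero, one_mul] at h0 h2
  rw [← div_eq_mul_inv, le_div_iff₀ (by positivity)]
  linarith

/-- A function on `ℂ` with inverse quadratic decay is integrable along every curve `g` with
`|r| ≤ ‖g r‖`. -/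
lemma integrable_comp_of_le_inv_one_add_sq {f : ℂ → ℂ} {C : ℝ} (hf : Continuous f)
    (hC : ∀ z, ‖f z‖ ≤ C * (1 + ‖z‖ ^ 2)⁻¹) {g : ℝ → ℂ} (hg : Continuous g)
    (hn : ∀ r, r ^ 2 ≤ ‖g r‖ ^ 2) : Integrable fun r => f (g r) := by
  have hC0 : 0 ≤ C := by simpa using (norm_nonneg _).trans (hC 0)
  refine (integrable_inv_one_add_sq.const_mul C).mono' (by fun_prop) (ae_of_all _ fun r => ?_)
  refine (hC _).trans ?_
  gcongr C * (1 + ?_)⁻¹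
  exact hn r

lemma norm_real_mul_circle (r : ℝ) (u : Circle) : ‖(r : ℂ) * u‖ ^ 2 = r ^ 2 := by
  rw [norm_mul, Circle.norm_coe, mul_one, Complex.norm_real, Real.norm_eq_abs, sq_abs]

lemma measurePreserving_circle_mul (u : Circle) :
    MeasurePreserving (fun z : ℂ => (u : ℂ) * z) :=
  (rotation u).measurePreserving

lemma measurableEmbedding_circle_mul (u : Circle) :
    MeasurableEmbedding (fun z : ℂ => (u : ℂ) * z) :=
  (rotation u).toHomeomorph.measurableEmbedding

lemma fourierC_eq_fourier (φ : SchwartzMap ℂ ℂ) :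
    fourierC φ = ⇑(FourierTransform.fourier φ) := by
  ext ξ
  rw [SchwartzMap.fourier_coe, Real.fourier_eq', fourierC]
  refine integral_congr_ae (ae_of_all _ fun x => ?_)
  simp only [smul_eq_mul, Complex.inner]
  rw [mul_comm]
  congr 4
  simp
  ring

/-- Integrating the Fourier transform along a line through the origin gives the integral of the
function along the orthogonal line. -/
lemma integral_fourierC_line (φ : SchwartzMap ℂ ℂ) (u : Circle) :
    ∫ r : ℝ, fourierC φ (r * u) = ∫ t : ℝ, φ (Complex.I * (t * u)) := by
  obtain ⟨C, hC⟩ := φ.exists_norm_le_mul_inv_one_add_sq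
  have hC0 : 0 ≤ C := by simpa using (norm_nonneg _).trans (hC 0)
  obtain ⟨D, hD⟩ := (FourierTransform.fourier φ).exists_norm_le_mul_inv_one_add_sq
  set g : ℝ × ℝ → ℂ := fun p => φ (u * (p.1 + p.2 * Complex.I)) with hg
  have hgc : Continuous g := φ.continuous.comp (by fun_prop)
  have hvp := Complex.volume_preserving_equiv_real_prod.symm
  have hemb := Complex.measurableEquivRealProd.symm.measurableEmbedding
  have hsymm : ∀ p : ℝ × ℝ, Complex.measurableEquivRealProd.symm p = p.1 + p.2 * Complex.I := by
    intro p
    apply Complex.ext <;> simp [Complex.measurableEquivRealProd_symm_apply]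
  have hgi : Integrable g (volume.prod volume) := by
    have h1 : Integrable (fun z : ℂ => φ (u * z)) :=
      (measurePreserving_circle_mul u).integrable_comp_of_integrable φ.integrable
    have h2 := hvp.integrable_comp_of_integrable h1
    refine h2.congr (ae_of_all _ fun p => ?_)
    simp [hg, hsymm]
  have hnorm : ∀ s t : ℝ, t ^ 2 ≤ ‖(u : ℂ) * (s + t * Complex.I)‖ ^ 2 := by
    intro s t
    rw [norm_mul, Circle.norm_coe, one_mul, Complex.sq_norm, Complex.normSq_add_mul_I]
    nlinarith [sq_nonneg s]
  set ψ : ℝ → ℂ := fun s => ∫ t : ℝ, g (s, t) with hψ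
  have hψi : Integrable ψ := hgi.integral_prod_left
  have hψc : Continuous ψ := by
    refine continuous_of_dominated (bound := fun t => C * (1 + t ^ 2)⁻¹)
      (fun s => (by fun_prop : Continuous fun t => g (s, t)).aestronglyMeasurable)
      (fun s => ae_of_all _ fun t => (hC _).trans ?_)
      (integrable_inv_one_add_sq.const_mul C) (ae_of_all _ fun t => by fun_prop)
    gcongr C * (1 + ?_)⁻¹
    exact hnorm s t
  have hψF : ∀ r : ℝ, FourierTransform.fourier ψ r = fourierC φ (r * u) := by
    intro r
    rw [Real.fourier_real_eq_integral_exp_smul, fourierC,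
      ← (measurePreserving_circle_mul u).integral_comp (measurableEmbedding_circle_mul u),
      ← hvp.integral_comp hemb]
    have hi : Integrable (fun p : ℝ × ℝ =>
        Complex.exp (↑(-2 * π * p.1 * r) * Complex.I) • g p) (volume.prod volume) := by
      refine hgi.norm.mono' (by fun_prop) (ae_of_all _ fun p => ?_)
      rw [norm_smul, Complex.norm_exp_ofReal_mul_I, one_mul]
    rw [volume_eq_prod]
    calc _ = ∫ s : ℝ, ∫ t : ℝ, Complex.exp (↑(-2 * π * s * r) * Complex.I) • g (s, t) := by
          simp_rw [integral_smul, hψ]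
      _ = _ := by
          rw [← integral_prod _ hi]
          refine integral_congr_ae (ae_of_all _ fun p => ?_)
          simp only [hsymm, hg, smul_eq_mul]
          rw [mul_comm]
          congr 4
          have : (u : ℂ) * (p.1 + p.2 * Complex.I) * (starRingEnd ℂ) (r * u)
              = r * (p.1 + p.2 * Complex.I) := by
            have hu : (u : ℂ) * (starRingEnd ℂ) u = 1 := by
              rw [Complex.mul_conj]; simp
            rw [map_mul, Complex.conj_ofReal]
            linear_combination (r * (p.1 + p.2 * Complex.I) : ℂ) * hu
          rw [this]
          simp
          ring
  have hFi : Integrable (FourierTransform.fourier ψ) := by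
    rw [funext hψF, fourierC_eq_fourier]
    exact integrable_comp_of_le_inv_one_add_sq (SchwartzMap.continuous _) hD (by fun_prop)
      fun r => (norm_real_mul_circle r u).ge
  have hinv := congrFun (hψc.fourierInv_fourier_eq hψi hFi) 0
  rw [Real.fourierInv_eq] at hinv
  simp only [inner_zero_right, AddChar.map_zero_eq_one, one_smul] at hinv
  simp_rw [← hψF, hinv, hψ, hg]
  refine integral_congr_ae (ae_of_all _ fun t => ?_)
  simp only [Complex.ofReal_zero, zero_add]
  congr 1
  ring

/-- Integration over a measurable cone in polar coordinates, with rays paired into lines. -/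
lemma two_smul_setIntegral_cone {K : Set ℂ} (hK : MeasurableSet K)
    (hcone : ∀ (r : ℝ) (z : ℂ), r ≠ 0 → ((r : ℂ) * z ∈ K ↔ z ∈ K))
    {f : ℂ → ℂ} {C : ℝ} (hf : Continuous f) (hC : ∀ z, ‖f z‖ ≤ C * (1 + ‖z‖ ^ 2)⁻¹) :
    2 * ∫ x in K, (‖x‖⁻¹ : ℝ) • f x
      = ∫ θ in Ioo (-π) π, K.indicator (fun _ => ∫ r : ℝ, f (r * Circle.exp θ))
          (Circle.exp θ : ℂ) := by
  have polar : ∀ g : ℂ → ℂ, Continuous g → (∀ z, ‖g z‖ ≤ C * (1 + ‖z‖ ^ 2)⁻¹) →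
      Integrable (fun θ : ℝ => K.indicator (fun _ => ∫ r in Ioi (0 : ℝ), g (r * Circle.exp θ))
          (Circle.exp θ : ℂ)) (volume.restrict (Ioo (-π) π)) ∧
      ∫ x in K, (‖x‖⁻¹ : ℝ) • g x
      = ∫ θ in Ioo (-π) π, K.indicator (fun _ => ∫ r in Ioi (0 : ℝ), g (r * Circle.exp θ))
          (Circle.exp θ : ℂ) := by
    intro g hg hgC
    set A : Set (ℝ × ℝ) := {p | (Circle.exp p.2 : ℂ) ∈ K} with hA
    have hAm : MeasurableSet A :=
      (by fun_prop : Continuous fun p : ℝ × ℝ => (Circle.exp p.2 : ℂ)).measurable hK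
    have hint : Integrable (A.indicator fun p => g (p.1 * Circle.exp p.2))
        ((volume.restrict (Ioi 0)).prod (volume.restrict (Ioo (-π) π))) := by
      refine Integrable.indicator ?_ hAm
      have hb := (integrable_inv_one_add_sq.const_mul C).restrict (s := Ioi 0) |>.mul_prod
        (integrable_const (1 : ℝ) (μ := volume.restrict (Ioo (-π) π)))
      refine hb.mono' (by fun_prop) (ae_of_all _ fun p => (hgC _).trans ?_)
      rw [norm_real_mul_circle, mul_one]
    have hin : ∀ θ : ℝ, ∫ r in Ioi (0 : ℝ), (A.indicator fun p => g (p.1 * Circle.exp p.2)) (r, θ)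
        = K.indicator (fun _ => ∫ r in Ioi (0 : ℝ), g (r * Circle.exp θ))
          (Circle.exp θ : ℂ) := by
      intro θ
      by_cases h : (Circle.exp θ : ℂ) ∈ K
      · simp only [indicator, hA, mem_ofPred_eq, h, if_true]
      · simp only [indicator, hA, mem_ofPred_eq, h, if_false, integral_zero]
    refine ⟨by simpa only [hin] using hint.integral_prod_right, ?_⟩
    simp_rw [← hin]
    rw [← integral_prod_symm _ hint, Measure.prod_restrict, ← integral_indicator hK,
      ← Complex.integral_comp_polarCoord_symm]
    refine setIntegral_congr_fun (measurableSet_Ioi.prod measurableSet_Ioo) fun p hp => ?_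
    have hp1 : 0 < p.1 := hp.1
    have hz : Complex.polarCoord.symm p = p.1 * Circle.exp p.2 := by
      rw [Complex.polarCoord_symm_apply, Circle.coe_exp, Complex.exp_mul_I]
      push_cast
      rfl
    simp only [hz, indicator, hA, mem_ofPred_eq, hcone _ _ hp1.ne']
    split_ifs
    · simp [abs_of_pos hp1, hp1.ne']
    · simp
  have hneg : ∫ x in K, (‖x‖⁻¹ : ℝ) • f (-x) = ∫ x in K, (‖x‖⁻¹ : ℝ) • f x := by
    rw [← (Measure.measurePreserving_neg (volume : Measure ℂ)).setIntegral_preimage_emb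
      (Homeomorph.neg ℂ).measurableEmbedding]
    have : Neg.neg ⁻¹' K = K := by
      ext z
      simpa using hcone (-1) z (by norm_num)
    simp [this]
  obtain ⟨hi, he⟩ := polar f hf hC
  obtain ⟨hi', he'⟩ := polar (fun z => f (-z)) (by fun_prop) (fun z => by simpa using hC (-z))
  rw [two_mul]
  nth_rewrite 1 [← hneg]
  rw [he', he, ← integral_add hi' hi]
  refine integral_congr_ae (ae_of_all _ fun θ => ?_)
  simp only [indicator]
  split_ifs
  · have hl : Integrable fun r : ℝ => f (r * Circle.exp θ) :=
      integrable_comp_of_le_inv_one_add_sq hf hC (by fun_prop)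
        fun r => (norm_real_mul_circle r _).ge
    rw [← intervalIntegral.integral_Iic_add_Ioi (b := 0) hl.integrableOn hl.integrableOn]
    congr 1
    have := integral_comp_neg_Ioi (0 : ℝ) fun r : ℝ => f (r * Circle.exp θ)
    simpa using this
  · simp

lemma real_mul_mem_coneOf_iff (J : Set ℝ) {r : ℝ} (z : ℂ) (hr : r ≠ 0) :
    (r : ℂ) * z ∈ coneOf J ↔ z ∈ coneOf J := by
  have key : ∀ (s : ℝ) (w : ℂ), w ∈ coneOf J → (s : ℂ) * w ∈ coneOf J := by
    rintro s w ⟨t, θ, hθ, rfl⟩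
    exact ⟨s * t, θ, hθ, by push_cast; ring⟩
  refine ⟨fun h => ?_, key r z⟩
  have := key r⁻¹ _ h
  rwa [Complex.ofReal_inv, inv_mul_cancel_left₀ (by exact_mod_cast hr)] at this

lemma I_mul_mem_coneOf_iff (J : Set ℝ) (z : ℂ) :
    Complex.I * z ∈ coneOf ((fun θ => θ + π / 2) '' J) ↔ z ∈ coneOf J := by
  have hexp : ∀ θ : ℝ, Complex.exp (((θ + π / 2 : ℝ) : ℂ) * Complex.I)
      = Complex.I * Complex.exp (θ * Complex.I) := by
    intro θ
    push_cast
    rw [add_mul, Complex.exp_add, Complex.exp_pi_div_two_mul_I, mul_comm]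
  constructor
  · rintro ⟨r, _, ⟨θ, hθ, rfl⟩, h⟩
    refine ⟨r, θ, hθ, mul_left_cancel₀ Complex.I_ne_zero ?_⟩
    rw [h, hexp]
    ring
  · rintro ⟨r, θ, hθ, rfl⟩
    exact ⟨r, _, ⟨θ, hθ, rfl⟩, by rw [hexp]; ring⟩

/-- Away from the origin, membership in the cone is detected by the argument modulo `π`. -/
lemma mem_coneOf_iff_arg {J : Set ℝ} (hJ : J ⊆ Ico 0 π) {z : ℂ} (hz : z ≠ 0) :
    z ∈ coneOf J ↔ z.arg ∈ J ∨ z.arg + π ∈ J ∨ z.arg - π ∈ J := by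
  have hpi := Real.pi_pos
  constructor
  · rintro ⟨r, θ, hθ, rfl⟩
    have hr : r ≠ 0 := by rintro rfl; simp at hz
    obtain ⟨h0, h1⟩ := hJ hθ
    have harg : ∀ s α : ℝ, 0 < s → α ∈ Ioc (-π) π →
        Complex.arg (s * Complex.exp (α * Complex.I)) = α := by
      intro s α hs hα
      rw [Complex.exp_mul_I, Complex.arg_mul_cos_add_sin_mul_I hs hα]
    rcases hr.lt_or_gt with hr | hr
    · rcases h0.eq_or_lt with rfl | h0
      · have : (r : ℂ) * Complex.exp ((0 : ℝ) * Complex.I)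
            = ((-r : ℝ) : ℂ) * Complex.exp (π * Complex.I) := by simp
        rw [this, harg _ _ (neg_pos.2 hr) ⟨by linarith, le_rfl⟩]
        simp [hθ]
      · have : (r : ℂ) * Complex.exp (θ * Complex.I)
            = ((-r : ℝ) : ℂ) * Complex.exp ((θ - π : ℝ) * Complex.I) := by
          push_cast
          rw [sub_mul, Complex.exp_sub_pi_mul_I]
          ring
        rw [this, harg _ _ (neg_pos.2 hr) ⟨by linarith, by linarith⟩]
        simp [hθ]
    · rw [harg _ _ hr ⟨by linarith, h1.le⟩]
      exact Or.inl hθ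
  · have hz' := Complex.norm_mul_exp_arg_mul_I z
    rintro (h | h | h)
    · exact ⟨‖z‖, _, h, hz'.symm⟩
    · refine ⟨-‖z‖, _, h, ?_⟩
      push_cast
      rw [add_mul, Complex.exp_add_pi_mul_I, neg_mul_neg, hz']
    · refine ⟨-‖z‖, _, h, ?_⟩
      push_cast
      rw [sub_mul, Complex.exp_sub_pi_mul_I, neg_mul_neg, hz']

lemma measurableSet_coneOf {J : Set ℝ} (hJm : MeasurableSet J) (hJ : J ⊆ Ico 0 π) :
    MeasurableSet (coneOf J) := by
  have hB : MeasurableSet {z : ℂ | z.arg ∈ J ∨ z.arg + π ∈ J ∨ z.arg - π ∈ J} :=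
    (Complex.measurable_arg hJm).union
      (((Complex.measurable_arg.add_const π) hJm).union ((Complex.measurable_arg.sub_const π) hJm))
  have hdiff : MeasurableSet (coneOf J \ {0}) := by
    have : coneOf J \ {0} = {z : ℂ | z.arg ∈ J ∨ z.arg + π ∈ J ∨ z.arg - π ∈ J} \ {0} := by
      ext z
      simp only [Set.mem_sdiff, mem_singleton_iff, and_congr_left_iff]
      exact mem_coneOf_iff_arg hJ
    rw [this]
    exact hB.diff (measurableSet_singleton 0)
  by_cases h0 : (0 : ℂ) ∈ coneOf J
  · have := hdiff.union (measurableSet_singleton 0)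
    rwa [sdiff_union_self, union_eq_left.2 (singleton_subset_iff.2 h0)] at this
  · rwa [sdiff_singleton_eq_self h0] at hdiff

/-- For a measurable `I ⊆ [0,π)` and a Schwartz function `φ : ℝ² → ℂ`,
`∫_{K_I} |x|⁻¹ \hatφ(x) dx = ∫_{K_{I⊥}} |x|⁻¹ φ(x) dx`, i.e. the distributional Fourier
transform of `χ_{K_I}(x)·|x|⁻¹` is `χ_{K_{I⊥}}(x)·|x|⁻¹` (here `I⊥ = I + π/2 (mod π)`, which
spans the same cone as `I + π/2`). -/
theorem statement6 (I : Set ℝ) (hI : MeasurableSet I) (hIsub : I ⊆ Set.Ico 0 π)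
    (φ : SchwartzMap ℂ ℂ) :
    (∫ x in coneOf I, (‖x‖⁻¹ : ℝ) • fourierC (⇑φ) x)
      = ∫ x in coneOf ((fun θ => θ + π / 2) '' I), (‖x‖⁻¹ : ℝ) • φ x := by
  have hK := measurableSet_coneOf hI hIsub
  have hcone := fun r z hr => real_mul_mem_coneOf_iff I (r := r) z hr
  obtain ⟨C, hC⟩ := φ.exists_norm_le_mul_inv_one_add_sq
  obtain ⟨D, hD⟩ := (FourierTransform.fourier φ).exists_norm_le_mul_inv_one_add_sq
  have hrot : ∫ x in coneOf ((fun θ => θ + π / 2) '' I), (‖x‖⁻¹ : ℝ) • φ x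
      = ∫ x in coneOf I, (‖x‖⁻¹ : ℝ) • φ (Complex.I * x) := by
    let u : Circle := ⟨Complex.I, by simp [Submonoid.unitSphere]⟩
    rw [← (measurePreserving_circle_mul u).setIntegral_preimage_emb
      (measurableEmbedding_circle_mul u)]
    have : (fun z : ℂ => (u : ℂ) * z) ⁻¹' coneOf ((fun θ => θ + π / 2) '' I) = coneOf I :=
      Set.ext fun z => I_mul_mem_coneOf_iff I z
    rw [this]
    simp [u]
  rw [hrot]
  refine mul_left_cancel₀ (two_ne_zero (α := ℂ)) ?_
  rw [two_smul_setIntegral_cone hK hcone (f := fun x => φ (Complex.I * x))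
      (φ.continuous.comp (by fun_prop)) (fun z => by simpa using hC (Complex.I * z)),
    two_smul_setIntegral_cone hK hcone (f := fourierC φ) (C := D)
      (by rw [fourierC_eq_fourier]; exact SchwartzMap.continuous _)
      (by rwa [fourierC_eq_fourier])]
  simp_rw [integral_fourierC_line]
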